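/- Let d ≥ 2 be an integer and let k₁, …, k_r be integers with kᵢ ≥ 2 for all i and ∑_{i=1}^{r} (kᵢ − 1) = d − 1. Then there exists a postcritically finite polynomial f ∈ ℂ[X] with natDegree f = d having exactly r distinct finite critical points c₁, …, c_r, such that the local degree of f at cᵢ equals kᵢ for each i. -/

import Mathlib

open Polynomial

namespace Polynomial

variable {R S : Type*} [CommRing R] [CommRing S] [Algebra ℂ R] [Algebra ℂ S]

/-- The antiderivative of a polynomial over a `ℂ`-algebra with vanishing constant term. -/
noncomputable def antideriv (p : R[X]) : R[X] :=
  p.sum fun n a => monomial (n + 1) (algebraMap ℂ R ((n : ℂ) + 1)⁻¹ * a)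

theorem coeff_antideriv_zero (p : R[X]) : (antideriv p).coeff 0 = 0 := by
  simp [antideriv, sum_def, finsetSum_coeff, coeff_monomial]

theorem coeff_antideriv_succ (p : R[X]) (n : ℕ) :
    (antideriv p).coeff (n + 1) = algebraMap ℂ R ((n : ℂ) + 1)⁻¹ * p.coeff n := by
  simp only [antideriv, sum_def, finsetSum_coeff, coeff_monomial, add_left_inj]
  rw [Finset.sum_ite_eq']
  split_ifs with h
  · rfl
  · rw [notMem_support_iff.mp h, mul_zero]

theorem derivative_antideriv (p : R[X]) : derivative (antideriv p) = p := by
  ext n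
  have h : ((n : ℂ) + 1) ≠ 0 := Nat.cast_add_one_ne_zero n
  have h' : ((n : R) + 1) = algebraMap ℂ R ((n : ℂ) + 1) := by simp
  rw [coeff_derivative, coeff_antideriv_succ, h', mul_right_comm, ← map_mul,
    inv_mul_cancel₀ h, map_one, one_mul]

theorem map_antideriv (φ : R →ₐ[ℂ] S) (p : R[X]) :
    (antideriv p).map (φ : R →+* S) = antideriv (p.map (φ : R →+* S)) := by
  ext n
  cases n with
  | zero => simp [coeff_antideriv_zero]
  | succ n => simp [coeff_antideriv_succ, -map_inv₀]

theorem natDegree_antideriv {p : ℂ[X]} (hp : p ≠ 0) :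
    (antideriv p).natDegree = p.natDegree + 1 := by
  have h := natDegree_derivative (antideriv p)
  rw [derivative_antideriv] at h
  have h0 : (antideriv p).natDegree ≠ 0 := by
    intro h0
    apply hp
    rw [← derivative_antideriv p, eq_C_of_natDegree_eq_zero h0, derivative_C]
  omega

theorem rootMultiplicity_eq_derivative_add_one {p : ℂ[X]} (hp : p ≠ 0) {x : ℂ}
    (hx : p.IsRoot x) : p.rootMultiplicity x = (derivative p).rootMultiplicity x + 1 := by
  have h := derivative_rootMultiplicity_of_root hx
  have h' := (rootMultiplicity_pos hp).mpr hx
  omega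

theorem rootMultiplicity_sub_C_eval {f : ℂ[X]} (hf : f.natDegree ≠ 0) (x : ℂ) :
    rootMultiplicity x (f - C (f.eval x)) = (derivative f).rootMultiplicity x + 1 := by
  have h0 : f - C (f.eval x) ≠ 0 := by
    intro h
    apply hf
    rw [sub_eq_zero.mp h, natDegree_C]
  rw [rootMultiplicity_eq_derivative_add_one h0 (by simp), derivative_sub, derivative_C, sub_zero]

/-- If `f` vanishes at all roots of its derivative, and at `0`, then `0` is the only
critical point of `f`. -/
theorem roots_eq_zero_of_derivative_roots {f : ℂ[X]} (h0 : f.IsRoot 0)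
    (hroot : ∀ x ∈ (derivative f).roots, f.IsRoot x) {x : ℂ} (hx : x ∈ (derivative f).roots) :
    x = 0 := by
  classical
  have hf' : derivative f ≠ 0 := ne_zero_of_mem_roots hx
  have hf : f ≠ 0 := by rintro rfl; simp at hf'
  set T : Finset ℂ := insert 0 (derivative f).roots.toFinset with hT
  have hTroot : ∀ y ∈ T, f.IsRoot y := by
    intro y hy
    rcases Finset.mem_insert.mp hy with rfl | hy
    · exact h0
    · exact hroot y (Multiset.mem_toFinset.mp hy)
  have hle : (derivative f).roots + T.val ≤ f.roots := by
    rw [Multiset.le_iff_count]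
    intro y
    rw [Multiset.count_add, count_roots, count_roots]
    by_cases hy : y ∈ T
    · rw [rootMultiplicity_eq_derivative_add_one hf (hTroot y hy)]
      have := Multiset.nodup_iff_count_le_one.mp T.nodup y
      omega
    · have h1 : T.val.count y = 0 := Multiset.count_eq_zero.mpr hy
      have h2 : (derivative f).rootMultiplicity y = 0 := by
        rw [← count_roots, Multiset.count_eq_zero]
        intro h
        exact hy (Finset.mem_insert_of_mem (Multiset.mem_toFinset.mpr h))
      omega
  have hcard := (Multiset.card_le_card hle).trans f.card_roots'
  rw [Multiset.card_add, IsAlgClosed.card_roots_eq_natDegree, natDegree_derivative,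
    Finset.card_val] at hcard
  have hT1 : T.card ≤ 1 := by omega
  exact Finset.card_le_one.mp hT1 x
    (Finset.mem_insert_of_mem (Multiset.mem_toFinset.mpr hx)) 0 (Finset.mem_insert_self _ _)

end Polynomial

namespace MvPolynomial

variable {K : Type*} [Field K]

/-- The vanishing ideal of the linear subspace on which the first `j` coordinates are zero. -/
noncomputable def coordIdeal (K : Type*) [Field K] (n j : ℕ) : Ideal (MvPolynomial (Fin n) K) :=
  RingHom.ker (aeval (R := K)
    fun i : Fin n => if (i : ℕ) < j then (0 : MvPolynomial (Fin n) K) else X i)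

instance (n j : ℕ) : (coordIdeal K n j).IsPrime := RingHom.ker_isPrime _

theorem coordIdeal_lt_succ {n j : ℕ} (hj : j < n) : coordIdeal K n j < coordIdeal K n (j + 1) := by
  refine lt_of_le_of_ne (fun p hp => ?_) fun h => ?_
  · have hcomp : (aeval (R := K)
          fun i : Fin n => if (i : ℕ) < j + 1 then (0 : MvPolynomial (Fin n) K) else X i) =
        (aeval (R := K)
          fun i : Fin n => if (i : ℕ) < j + 1 then (0 : MvPolynomial (Fin n) K) else X i).comp
        (aeval (R := K)
          fun i : Fin n => if (i : ℕ) < j then (0 : MvPolynomial (Fin n) K) else X i) := by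
      ext1 i
      by_cases h : (i : ℕ) < j
      · simp [h, h.le]
      · simp [h]
    rw [coordIdeal, RingHom.mem_ker] at hp ⊢
    rw [hcomp, AlgHom.comp_apply, hp, map_zero]
  · have hX : (X ⟨j, hj⟩ : MvPolynomial (Fin n) K) ∈ coordIdeal K n (j + 1) := by
      simp [coordIdeal, RingHom.mem_ker]
    rw [← h] at hX
    simp [coordIdeal, RingHom.mem_ker] at hX

theorem le_height_coordIdeal {n j : ℕ} (hj : j ≤ n) : (j : ℕ∞) ≤ (coordIdeal K n j).height := by
  induction j with
  | zero => simp
  | succ j ih =>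
    have h := Ideal.height_add_one_le_of_lt_of_isPrime (coordIdeal_lt_succ (K := K) hj)
    push_cast
    exact (add_le_add_left (ih (by omega)) 1).trans h

theorem le_height_vanishingIdeal_zero (n : ℕ) :
    (n : ℕ∞) ≤ (vanishingIdeal K {(0 : Fin n → K)} : Ideal (MvPolynomial (Fin n) K)).height := by
  refine (le_height_coordIdeal le_rfl).trans (Ideal.height_mono fun p hp => ?_)
  rw [mem_vanishingIdeal_singleton_iff]
  have hcomp : (aeval (R := K) (0 : Fin n → K)) =
      (aeval (R := K) (0 : Fin n → K)).comp (aeval (R := K)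
        fun i : Fin n => if (i : ℕ) < n then (0 : MvPolynomial (Fin n) K) else X i) := by
    ext1 i
    simp
  rw [coordIdeal, RingHom.mem_ker] at hp
  rw [hcomp, AlgHom.comp_apply, hp, map_zero]

/-- Fewer than `n` polynomials in `n` variables that vanish at the origin have another
common zero. -/
theorem exists_ne_zero_common_zero [IsAlgClosed K] {n : ℕ} (s : Finset (MvPolynomial (Fin n) K))
    (hs : s.card < n) (h0 : ∀ p ∈ s, aeval (0 : Fin n → K) p = 0) :
    ∃ x : Fin n → K, x ≠ 0 ∧ ∀ p ∈ s, aeval x p = 0 := by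
  by_contra! hcon
  have hzero : zeroLocus K (Ideal.span (s : Set (MvPolynomial (Fin n) K))) = {0} := by
    rw [zeroLocus_span]
    ext x
    refine ⟨fun hx => ?_, ?_⟩
    · by_contra hne
      obtain ⟨p, hp, hpx⟩ := hcon x hne
      exact hpx (hx p hp)
    · rintro rfl
      exact h0
  have hrad := vanishingIdeal_zeroLocus_eq_radical (K := K)
    (Ideal.span (s : Set (MvPolynomial (Fin n) K)))
  rw [hzero] at hrad
  have hmin : vanishingIdeal K {(0 : Fin n → K)} ∈
      (Ideal.span (s : Set (MvPolynomial (Fin n) K))).minimalPrimes := by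
    rw [← Ideal.radical_minimalPrimes, ← hrad, Ideal.minimalPrimes_eq_subsingleton_self]
    rfl
  have h := (le_height_vanishingIdeal_zero (K := K) n).trans
    (Ideal.height_le_card_of_mem_minimalPrimes_span_finset hmin)
  exact absurd (Nat.cast_le.mp h) (by omega)

end MvPolynomial

/-- For `r ≥ 2` there is a nonzero tuple `c` such that the antiderivative of
`∏ (X - cᵢ) ^ mᵢ` is a linear polynomial `a * X` modulo `∏ (X - cᵢ)`. -/
theorem exists_ne_zero_prod_dvd_antideriv_sub {r : ℕ} (hr : 2 ≤ r) (m : Fin r → ℕ)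
    (hm : ∀ i, 1 ≤ m i) :
    ∃ c : Fin r → ℂ, c ≠ 0 ∧ ∃ a : ℂ,
      ∏ i, (X - C (c i)) ∣ antideriv (∏ i, (X - C (c i)) ^ m i) - C a * X := by
  classical
  let Q : (MvPolynomial (Fin r) ℂ)[X] := ∏ i, (X - C (MvPolynomial.X i))
  let F : (MvPolynomial (Fin r) ℂ)[X] := antideriv (∏ i, (X - C (MvPolynomial.X i)) ^ m i)
  have hQ : Q.Monic := monic_prod_of_monic _ _ fun i _ => monic_X_sub_C _
  have hq (c : Fin r → ℂ) : (∏ i, (X - C (c i))).Monic :=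
    monic_prod_of_monic _ _ fun i _ => monic_X_sub_C _
  have hcoeff (c : Fin r → ℂ) (j : ℕ) : MvPolynomial.aeval (R := ℂ) c ((F %ₘ Q).coeff j) =
      (antideriv (∏ i, (X - C (c i)) ^ m i) %ₘ ∏ i, (X - C (c i))).coeff j := by
    have h := map_modByMonic (f := ((MvPolynomial.aeval (R := ℂ) c :
      MvPolynomial (Fin r) ℂ →ₐ[ℂ] ℂ) : MvPolynomial (Fin r) ℂ →+* ℂ)) (p := F) hQ
    rw [map_antideriv] at h
    simp only [Q, Polynomial.map_prod, Polynomial.map_pow, Polynomial.map_sub, map_X, map_C,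
      RingHom.coe_coe, MvPolynomial.aeval_X] at h
    rw [← h, coeff_map]
    rfl
  obtain ⟨c, hc0, hc⟩ := MvPolynomial.exists_ne_zero_common_zero
    (((Finset.range r).erase 1).image fun j => (F %ₘ Q).coeff j)
    (Finset.card_image_le.trans_lt (by
      rw [Finset.card_erase_of_mem (Finset.mem_range.mpr hr), Finset.card_range]; omega))
    (by
      intro p hp
      obtain ⟨j, -, rfl⟩ := Finset.mem_image.mp hp
      rw [hcoeff]
      have hdvd : (∏ i : Fin r, (X - C ((0 : Fin r → ℂ) i))) ∣
          antideriv (∏ i, (X - C ((0 : Fin r → ℂ) i)) ^ m i) := by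
        have hle : r ≤ ∑ i, m i := by
          simpa using Finset.card_nsmul_le_sum Finset.univ m 1 fun i _ => hm i
        simp only [Pi.zero_apply, map_zero, sub_zero, Finset.prod_const, Finset.card_univ,
          Fintype.card_fin, Finset.prod_pow_eq_pow_sum]
        rw [X_pow_dvd_iff]
        intro n hn
        cases n with
        | zero => exact coeff_antideriv_zero _
        | succ n => rw [coeff_antideriv_succ, coeff_X_pow, if_neg (by omega), mul_zero]
      rw [(modByMonic_eq_zero_iff_dvd (hq 0)).mpr hdvd, coeff_zero])
  refine ⟨c, hc0, (antideriv (∏ i, (X - C (c i)) ^ m i) %ₘ ∏ i, (X - C (c i))).coeff 1, ?_⟩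
  have hrem : antideriv (∏ i, (X - C (c i)) ^ m i) %ₘ ∏ i, (X - C (c i)) =
      C ((antideriv (∏ i, (X - C (c i)) ^ m i) %ₘ ∏ i, (X - C (c i))).coeff 1) * X := by
    have hdeg : (∏ i, (X - C (c i))).natDegree = r := by
      rw [natDegree_prod_of_monic _ _ fun i _ => monic_X_sub_C _]
      simp
    have hlt : (antideriv (∏ i, (X - C (c i)) ^ m i) %ₘ ∏ i, (X - C (c i))).natDegree < r := by
      have h := natDegree_modByMonic_lt (antideriv (∏ i, (X - C (c i)) ^ m i)) (hq c) (by
        intro h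
        rw [h, natDegree_one] at hdeg
        omega)
      rwa [hdeg] at h
    ext j
    rw [coeff_C_mul, coeff_X]
    split_ifs with hj
    · rw [← hj, mul_one]
    · rw [mul_zero]
      by_cases hjr : j < r
      · rw [← hcoeff]
        exact hc _ (Finset.mem_image_of_mem _
          (Finset.mem_erase.mpr ⟨fun h => hj h.symm, Finset.mem_range.mpr hjr⟩))
      · exact coeff_eq_zero_of_natDegree_lt (by omega)
  rw [← hrem, modByMonic_eq_sub_mul_div (antideriv (∏ i, (X - C (c i)) ^ m i)), sub_sub_cancel]
  exact dvd_mul_right _ _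

/-- There is a polynomial with derivative `a * ∏ (X - cᵢ) ^ mᵢ` all of whose critical points
`cᵢ` are fixed. -/
theorem exists_derivative_eq_prod_and_prod_dvd_sub_X {r : ℕ} (hr : 1 ≤ r) (m : Fin r → ℕ)
    (hm : ∀ i, 1 ≤ m i) :
    ∃ (f : ℂ[X]) (c : Fin r → ℂ) (a : ℂ), a ≠ 0 ∧
      derivative f = C a * ∏ i, (X - C (c i)) ^ m i ∧ ∏ i, (X - C (c i)) ∣ f - X := by
  rcases hr.eq_or_lt with rfl | hr
  · refine ⟨antideriv (X ^ m 0), 0, 1, one_ne_zero, ?_, ?_⟩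
    · simp [derivative_antideriv]
    · have h := coeff_antideriv_zero (X ^ m 0 : ℂ[X])
      simp [X_dvd_iff, h]
  obtain ⟨c, hc0, a, hdvd⟩ := exists_ne_zero_prod_dvd_antideriv_sub hr m hm
  set p : ℂ[X] := ∏ i, (X - C (c i)) ^ m i with hp
  have hp0 : p ≠ 0 := (monic_prod_of_monic _ _ fun i _ => (monic_X_sub_C _).pow _).ne_zero
  have hroots (x : ℂ) : p.IsRoot x ↔ ∃ i, x = c i := by
    simp only [hp, IsRoot.def, eval_prod, Finset.prod_eq_zero_iff, eval_pow, eval_sub, eval_X,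
      eval_C, Finset.mem_univ, true_and, pow_eq_zero_iff (Nat.one_le_iff_ne_zero.mp (hm _)),
      sub_eq_zero]
  have ha : a ≠ 0 := by
    rintro rfl
    rw [C_0, zero_mul, sub_zero] at hdvd
    apply hc0
    funext i
    refine roots_eq_zero_of_derivative_roots (f := antideriv p) ?_ ?_ ?_
    · rw [IsRoot.def, ← coeff_zero_eq_eval_zero, coeff_antideriv_zero]
    · rw [derivative_antideriv]
      intro x hx
      obtain ⟨j, rfl⟩ := (hroots x).mp (isRoot_of_mem_roots hx)
      exact dvd_iff_isRoot.mp
        ((Finset.dvd_prod_of_mem (fun i => X - C (c i)) (Finset.mem_univ j)).trans hdvd)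
    · rw [derivative_antideriv, mem_roots hp0]
      exact (hroots _).mpr ⟨i, rfl⟩
  refine ⟨C a⁻¹ * antideriv p, c, a⁻¹, inv_ne_zero ha, ?_, ?_⟩
  · rw [derivative_C_mul, derivative_antideriv]
  · have h : C a⁻¹ * antideriv p - X = C a⁻¹ * (antideriv p - C a * X) := by
      rw [mul_sub, ← mul_assoc, ← C_mul, inv_mul_cancel₀ ha, C_1, one_mul]
    rw [h]
    exact hdvd.mul_left _

/-- If every critical point `cᵢ` of `f` is fixed, with all indices counted as roots of `f - X`,
then distinct indices give distinct critical points. -/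
theorem injective_of_prod_dvd_sub_X {ι : Type*} [Fintype ι] {f : ℂ[X]} {c : ι → ℂ}
    (hcrit : ∀ i, (derivative f).eval (c i) = 0) (hdvd : ∏ i, (X - C (c i)) ∣ f - X) :
    Function.Injective c := by
  classical
  intro i j hij
  by_contra hne
  have hpair : (X - C (c i)) * (X - C (c i)) ∣ f - X := by
    have h : ∏ l ∈ ({i, j} : Finset ι), (X - C (c l)) ∣ ∏ l, (X - C (c l)) :=
      Finset.prod_dvd_prod_of_subset _ _ _ (Finset.subset_univ _)
    rw [Finset.prod_pair hne, ← hij] at h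
    exact h.trans hdvd
  obtain ⟨q, hq⟩ := hpair
  have h := congrArg (fun p => (derivative p).eval (c i)) hq
  simp [derivative_mul, hcrit i] at h

/-- All polynomial branch data are realized by postcritically finite polynomials:
given `d ≥ 2` and `k₁, …, k_r ≥ 2` with `∑ (kᵢ − 1) = d − 1`, there is a postcritically
finite polynomial of degree `d` with exactly `r` distinct finite critical points of the
prescribed local degrees. -/
theorem realize_polynomial_branch_data
    (d : ℕ) (hd : 2 ≤ d) (r : ℕ) (k : Fin r → ℕ)
    (hk : ∀ i, 2 ≤ k i)
    (hsum : ∑ i, (k i - 1) = d - 1) :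
    ∃ f : ℂ[X], f.natDegree = d ∧
      ∃ c : Fin r → ℂ,
        Function.Injective c ∧
        (∀ x : ℂ, 2 ≤ rootMultiplicity x (f - C (f.eval x)) ↔ ∃ i, x = c i) ∧
        (∀ i, rootMultiplicity (c i) (f - C (f.eval (c i))) = k i) ∧
        ({y : ℂ | ∃ x m, 2 ≤ rootMultiplicity x (f - C (f.eval x)) ∧ 1 ≤ m ∧
          (fun z => f.eval z)^[m] x = y}).Finite := by
  obtain ⟨f, c, a, ha, hder, hdvd⟩ := exists_derivative_eq_prod_and_prod_dvd_sub_X (r := r)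
    (by
      rcases Nat.eq_zero_or_pos r with rfl | h
      · simp at hsum
        omega
      · exact h)
    (fun i => k i - 1) (fun i => Nat.le_sub_one_of_lt (hk i))
  set p : ℂ[X] := ∏ i, (X - C (c i)) ^ (k i - 1) with hp
  have hpmonic : p.Monic := monic_prod_of_monic _ _ fun i _ => (monic_X_sub_C _).pow _
  have hpdeg : p.natDegree = d - 1 := by
    rw [hp, natDegree_prod_of_monic _ _ fun i _ => (monic_X_sub_C _).pow _]
    simpa using hsum
  have hroots (x : ℂ) : p.IsRoot x ↔ ∃ i, x = c i := by
    have hk' (i : Fin r) : k i - 1 ≠ 0 := by have := hk i; omega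
    simp only [hp, IsRoot.def, eval_prod, Finset.prod_eq_zero_iff, eval_pow, eval_sub, eval_X,
      eval_C, Finset.mem_univ, true_and, pow_eq_zero_iff (hk' _), sub_eq_zero]
  have hfdeg : f.natDegree = d := by
    have h := natDegree_derivative f
    rw [hder, natDegree_C_mul ha, hpdeg] at h
    omega
  have hinj : Function.Injective c := by
    refine injective_of_prod_dvd_sub_X (f := f) (fun i => ?_) hdvd
    rw [hder, eval_mul, (hroots (c i)).mpr ⟨i, rfl⟩, mul_zero]
  have hfix (i : Fin r) : f.eval (c i) = c i := by
    have h := dvd_iff_isRoot.mp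
      ((Finset.dvd_prod_of_mem (fun i => X - C (c i)) (Finset.mem_univ i)).trans hdvd)
    simpa [sub_eq_zero] using h
  have hmult (x : ℂ) : rootMultiplicity x (f - C (f.eval x)) = p.rootMultiplicity x + 1 := by
    rw [rootMultiplicity_sub_C_eval (by omega), hder, ← count_roots, roots_C_mul _ ha, count_roots]
  have hcrit (x : ℂ) : 2 ≤ rootMultiplicity x (f - C (f.eval x)) ↔ ∃ i, x = c i := by
    rw [hmult, ← hroots, ← rootMultiplicity_pos hpmonic.ne_zero]
    omega
  refine ⟨f, hfdeg, c, hinj, hcrit, fun i => ?_, ?_⟩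
  · have hsplit : p = (∏ j ∈ Finset.univ.erase i, (X - C (c j)) ^ (k j - 1)) *
        (X - C (c i)) ^ (k i - 1) := (Finset.prod_erase_mul _ _ (Finset.mem_univ i)).symm
    have hne : ¬ (∏ j ∈ Finset.univ.erase i, (X - C (c j)) ^ (k j - 1)).IsRoot (c i) := by
      rw [IsRoot.def, eval_prod, Finset.prod_eq_zero_iff]
      rintro ⟨j, hj, h⟩
      rw [eval_pow, eval_sub, eval_X, eval_C] at h
      exact (Finset.mem_erase.mp hj).1 (hinj (sub_eq_zero.mp (eq_zero_of_pow_eq_zero h)).symm)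
    rw [hmult, hsplit, rootMultiplicity_mul (hsplit ▸ hpmonic.ne_zero),
      rootMultiplicity_eq_zero hne, rootMultiplicity_X_sub_C_pow]
    have := hk i
    omega
  · refine (Set.finite_range c).subset ?_
    rintro y ⟨x, n, hx, -, rfl⟩
    obtain ⟨i, rfl⟩ := (hcrit x).mp hx
    exact ⟨i, (Function.iterate_fixed (hfix i) n).symm⟩
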